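/- Assume condition w3(𝒜, p, σ) is not satisfied for some parameters 1 < p < ∞ and 0 < σ < p. Then, for each positive integer N, there exists a chain of atoms (X_i)_{i=0}^n such that the function f = 1_{X_0∖X_n} − γ·1_{X_n}, with γ = |X_0∖X_n|/|X_n| chosen so that f has mean zero, satisfies: (1) ‖f‖_{V_{σ,p}} ≤ C·|X_0∖X_n|^{1/p}; and (2) there exists a subset Γ of the Haar support of f such that |Σ_{ℓ∈Γ} ⟨f, φ_ℓ⟩ φ_ℓ|_{V_{σ,p}} ≥ c·N·|X_0∖X_n|^{1/p}, where the constants C, c > 0 are independent of N. -/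

import Mathlib

open MeasureTheory ENNReal Set Filter
open scoped ENNReal NNReal Classical

noncomputable section

variable {Ω : Type} [MeasurableSpace Ω]

/-- The data of a filtration on `Ω`, recorded through the (finitely many) atoms of each
σ-algebra `ℱ_n`. -/
structure FiltrationAtoms (Ω : Type) [MeasurableSpace Ω] (μ : Measure Ω) where
  atoms : ℕ → Set (Set Ω)
  atoms_finite : ∀ n, (atoms n).Finite
  atoms_measurable : ∀ n, ∀ A ∈ atoms n, MeasurableSet A
  atoms_zero : atoms 0 = {Set.univ}
  atoms_disjoint : ∀ n, (atoms n).Pairwise Disjoint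
  atoms_cover : ∀ n, ⋃₀ atoms n = Set.univ
  atoms_pos : ∀ n, ∀ A ∈ atoms n, 0 < μ A
  atoms_refine : ∀ n, ∀ B ∈ atoms (n + 1), ∃ A ∈ atoms n, B ⊆ A

namespace FiltrationAtoms

variable {μ : Measure Ω}

/-- The collection `𝒜` of all atoms of the filtration. -/
def Atoms (F : FiltrationAtoms Ω μ) : Set (Set Ω) := ⋃ n, F.atoms n

/-- A `ν`-ary filtration: every atom of `ℱ_n` is the union of at most `ν` atoms of `ℱ_{n+1}`. -/
def IsNuAry (F : FiltrationAtoms Ω μ) (ν : ℕ) : Prop :=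
  ∀ n, ∀ A ∈ F.atoms n, ∃ T : Finset (Set Ω),
    T.card ≤ ν ∧ ↑T ⊆ F.atoms (n + 1) ∧ A = ⋃₀ ↑T

/-- A binary filtration: in the passage from `ℱ_n` to `ℱ_{n+1}`, exactly one atom `A` is
subdivided into two atoms `A'`, `A''` of positive measure with `μ A' ≤ μ A''`. -/
def IsBinary (F : FiltrationAtoms Ω μ) : Prop :=
  ∀ n, ∃ A ∈ F.atoms n, ∃ A' A'' : Set Ω, A' ∈ F.atoms (n + 1) ∧ A'' ∈ F.atoms (n + 1) ∧
    Disjoint A' A'' ∧ A = A' ∪ A'' ∧ μ A' ≤ μ A'' ∧ 0 < μ A' ∧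
    F.atoms (n + 1) = insert A' (insert A'' (F.atoms n \ {A}))

/-- `B` is one of the atoms into which the atom `A` is subdivided. -/
def IsChildOf (F : FiltrationAtoms Ω μ) (B A : Set Ω) : Prop :=
  ∃ n, A ∈ F.atoms n ∧ B ∈ F.atoms (n + 1) ∧ B ⊂ A

/-- `R` is an atom or a (nonempty) ring, i.e. a difference `A \ B` of two nested atoms. -/
def IsAtomOrRing (F : FiltrationAtoms Ω μ) (R : Set Ω) : Prop :=
  R ∈ F.Atoms ∨ ∃ A ∈ F.Atoms, ∃ B ∈ F.Atoms, B ⊆ A ∧ R = A \ B ∧ R.Nonempty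

end FiltrationAtoms

/-- The stability condition on the finite-dimensional space `S`:
there are `c₁, c₂ ∈ (0,1]` with `|{ω ∈ A : |f ω| ≥ c₁ ‖f‖_{L^∞(A)}}| ≥ c₂ |A|` for all
`f ∈ S` and all atoms `A`. -/
def StabilityCondition {μ : Measure Ω} (F : FiltrationAtoms Ω μ)
    (S : Submodule ℝ (Ω → ℝ)) : Prop :=
  ∃ c₁ ∈ Set.Ioc (0:ℝ) 1, ∃ c₂ ∈ Set.Ioc (0:ℝ) 1,
    ∀ A ∈ F.Atoms, ∀ f ∈ S,
      ENNReal.ofReal c₂ * μ A ≤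
        μ {ω | ω ∈ A ∧
          ENNReal.ofReal c₁ * eLpNormEssSup f (μ.restrict A) ≤ ENNReal.ofReal |f ω|}

/-- `E_p(f,R)`: the error of best `L^p(R)`-approximation of `f` by elements of `S` (restricted
to `R`). -/
def Ep (S : Submodule ℝ (Ω → ℝ)) (p : ℝ) (μ : Measure Ω) (f : Ω → ℝ) (R : Set Ω) : ℝ≥0∞ :=
  ⨅ g ∈ S, eLpNorm (f - g) (ENNReal.ofReal p) (μ.restrict R)

/-- The ring-variation seminorm `|f|_{V_{σ,p}}`: the supremum of
`(∑_{R ∈ P} E_p(f,R)^σ)^{1/σ}` over all finite collections `P` of pairwise disjoint atoms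
or rings. -/
def varSeminorm {μ : Measure Ω} (F : FiltrationAtoms Ω μ)
    (S : Submodule ℝ (Ω → ℝ)) (σ p : ℝ) (f : Ω → ℝ) : ℝ≥0∞ :=
  ⨆ (P : Finset (Set Ω)) (_ : ∀ R ∈ P, F.IsAtomOrRing R)
    (_ : (↑P : Set (Set Ω)).Pairwise Disjoint),
    (∑ R ∈ P, Ep S p μ f R ^ σ) ^ (1 / σ)

/-- The full variation norm `‖f‖_{V_{σ,p}} = ‖f‖_p + |f|_{V_{σ,p}}`. -/
def varNorm {μ : Measure Ω} (F : FiltrationAtoms Ω μ)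
    (S : Submodule ℝ (Ω → ℝ)) (σ p : ℝ) (f : Ω → ℝ) : ℝ≥0∞ :=
  eLpNorm f (ENNReal.ofReal p) μ + varSeminorm F S σ p f

/-- The dictionary `𝒞 = {g·1_A : g ∈ S, A ∈ 𝒜}`. -/
def dictC {μ : Measure Ω} (F : FiltrationAtoms Ω μ) (S : Submodule ℝ (Ω → ℝ)) :
    Set (Ω → ℝ) :=
  {h | ∃ g ∈ S, ∃ A ∈ F.Atoms, h = A.indicator g}

/-- `Σ_n^D`: linear combinations of at most `n` elements of the dictionary `D`. -/
def SigmaN (D : Set (Ω → ℝ)) (n : ℕ) : Set (Ω → ℝ) :=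
  {h | ∃ c : Fin n → ℝ, ∃ x : Fin n → Ω → ℝ, (∀ j, x j ∈ D) ∧ h = ∑ j, c j • x j}

/-- `σ_n(f, D)`: the error of best `n`-term approximation in `L^p` with respect to the
dictionary `D`. -/
def bestApprox (D : Set (Ω → ℝ)) (p : ℝ) (μ : Measure Ω) (f : Ω → ℝ) (n : ℕ) : ℝ≥0∞ :=
  ⨅ y ∈ SigmaN D n, eLpNorm (f - y) (ENNReal.ofReal p) μ

/-- The `ℓ^q` norm (`0 < q ≤ ∞`) of a sequence of extended nonnegative reals. -/
def lqNorm (q : ℝ≥0∞) (a : ℕ → ℝ≥0∞) : ℝ≥0∞ :=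
  if q = ∞ then ⨆ n, a n else (∑' n, a n ^ q.toReal) ^ (1 / q.toReal)

/-- The quasi-norm of the approximation space `𝒜_q^α`:
`‖f‖_p + ‖(2^{nα} σ_{2^n}(f,D))_n‖_{ℓ^q}`. -/
def approxNorm (D : Set (Ω → ℝ)) (p : ℝ) (q : ℝ≥0∞) (α : ℝ) (μ : Measure Ω)
    (f : Ω → ℝ) : ℝ≥0∞ :=
  eLpNorm f (ENNReal.ofReal p) μ +
    lqNorm q (fun n => (2 : ℝ≥0∞) ^ ((n : ℝ) * α) * bestApprox D p μ f (2 ^ n))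

/-- Membership in `L^p(S)`, the `L^p`-closure of the span of the dictionary `𝒞`. -/
def MemLpS {μ : Measure Ω} (F : FiltrationAtoms Ω μ) (S : Submodule ℝ (Ω → ℝ)) (p : ℝ)
    (f : Ω → ℝ) : Prop :=
  AEMeasurable f μ ∧ eLpNorm f (ENNReal.ofReal p) μ ≠ ∞ ∧
    ∀ ε : ℝ≥0∞, 0 < ε → ∃ n, ∃ y ∈ SigmaN (dictC F S) n,
      eLpNorm (f - y) (ENNReal.ofReal p) μ < ε

/-- Membership in the variation space `V_{σ,p}(S)`. -/
def MemVar {μ : Measure Ω} (F : FiltrationAtoms Ω μ) (S : Submodule ℝ (Ω → ℝ)) (σ p : ℝ)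
    (f : Ω → ℝ) : Prop :=
  MemLpS F S p f ∧ varSeminorm F S σ p f ≠ ∞

/-- The K-functional `K(f, t, L^p, Y)` for a subset `Y` of functions with (quasi-)norm
`yNorm`. -/
def Kfun (p : ℝ) (μ : Measure Ω) (Y : Set (Ω → ℝ)) (yNorm : (Ω → ℝ) → ℝ≥0∞)
    (f : Ω → ℝ) (t : ℝ≥0∞) : ℝ≥0∞ :=
  ⨅ g ∈ Y, eLpNorm (f - g) (ENNReal.ofReal p) μ + t * yNorm g

/-- The quasi-norm of the real interpolation space `(L^p, Y)_{θ,q}`, namely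
`‖(2^{nθ} K(f, 2^{-n}))_n‖_{ℓ^q}`. -/
def interpNorm (p : ℝ) (μ : Measure Ω) (Y : Set (Ω → ℝ)) (yNorm : (Ω → ℝ) → ℝ≥0∞)
    (θ : ℝ) (q : ℝ≥0∞) (f : Ω → ℝ) : ℝ≥0∞ :=
  lqNorm q (fun n => (2 : ℝ≥0∞) ^ ((n : ℝ) * θ) *
    Kfun p μ Y yNorm f ((2 : ℝ≥0∞) ^ (-(n : ℝ))))

/-- The modulus of smoothness `𝒲_S(f,t)_{σ,p}`; the supremum ranges over all finite
partitions of `Ω` into pairwise disjoint atoms or rings. -/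
def modW {μ : Measure Ω} (F : FiltrationAtoms Ω μ) (S : Submodule ℝ (Ω → ℝ)) (σ p : ℝ)
    (f : Ω → ℝ) (t : ℝ) : ℝ≥0∞ :=
  ⨆ (P : Finset (Set Ω)) (_ : ∀ R ∈ P, F.IsAtomOrRing R)
    (_ : (↑P : Set (Set Ω)).Pairwise Disjoint) (_ : ⋃₀ (↑P : Set (Set Ω)) = Set.univ),
    min (ENNReal.ofReal t) ((P.card : ℝ≥0∞)⁻¹) ^ (1 / σ - 1 / p) *
      (∑ R ∈ P, Ep S p μ f R ^ σ) ^ (1 / σ)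

/-- `h` belongs to `S(ℱ_n)`: on each atom of `ℱ_n`, `h` agrees with some element of `S`. -/
def PiecewiseS {μ : Measure Ω} (F : FiltrationAtoms Ω μ) (S : Submodule ℝ (Ω → ℝ)) (n : ℕ)
    (h : Ω → ℝ) : Prop :=
  ∀ A ∈ F.atoms n, ∃ g ∈ S, Set.EqOn h g A

/-- The near-best approximation operator `W_μ f = ∑_{A ∈ 𝒜_μ} f_A · 1_A` built from a
selection `fA` of near-best approximants on atoms. -/
def Wop {μ : Measure Ω} (F : FiltrationAtoms Ω μ) (fA : (Ω → ℝ) → Set Ω → Ω → ℝ)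
    (f : Ω → ℝ) (n : ℕ) : Ω → ℝ :=
  ∑ A ∈ (F.atoms_finite n).toFinset, A.indicator (fA f A)

end

section
variable {Ω : Type} [MeasurableSpace Ω]

/-- The expansion coefficient `⟨f, φ_k⟩` of `f` with respect to the orthonormal system `Φ`. -/
noncomputable def ExpansionCoef (Φ : ℕ → Ω → ℝ) (μ : Measure Ω) (f : Ω → ℝ) (k : ℕ) : ℝ :=
  ∫ ω, f ω * Φ k ω ∂μ

/-- `g` is an `m`-term greedy approximant of `f` in `L^p` with respect to the
`L^p`-renormalized system `Φ`: the terms `⟨f,φ_k⟩ φ_k` are summed along a rearrangement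
making the `L^p`-normalized coefficients `|⟨f,φ_k⟩| ‖φ_k‖_p` decreasing. -/
noncomputable def IsGreedyApproxPhi (Φ : ℕ → Ω → ℝ) (p : ℝ) (μ : Measure Ω)
    (f : Ω → ℝ) (m : ℕ) (g : Ω → ℝ) : Prop :=
  ∃ π : ℕ → ℕ, Function.Bijective π ∧
    (∀ i j, i ≤ j →
      ENNReal.ofReal |ExpansionCoef Φ μ f (π j)| *
          eLpNorm (Φ (π j)) (ENNReal.ofReal p) μ ≤
        ENNReal.ofReal |ExpansionCoef Φ μ f (π i)| *
          eLpNorm (Φ (π i)) (ENNReal.ofReal p) μ) ∧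
    g = fun ω => ∑ j ∈ Finset.range m, ExpansionCoef Φ μ f (π j) * Φ (π j) ω

/-- The `L^p`-renormalization of `Φ` is a greedy basis of `L^p(S)`: every `f ∈ L^p(S)` has
an expansion converging in `L^p`, and greedy approximants realize the best `m`-term
approximation up to a uniform constant. -/
noncomputable def GreedyBasisLp {μ : Measure Ω} (F : FiltrationAtoms Ω μ)
    (S : Submodule ℝ (Ω → ℝ)) (Φ : ℕ → Ω → ℝ) (p : ℝ) : Prop :=
  (∀ f : Ω → ℝ, MemLpS F S p f →
    Tendsto (fun N => eLpNorm
      (f - fun ω => ∑ k ∈ Finset.range N, ExpansionCoef Φ μ f k * Φ k ω)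
      (ENNReal.ofReal p) μ) atTop (nhds 0)) ∧
  ∃ C : ℝ≥0∞, C ≠ ∞ ∧ ∀ f : Ω → ℝ, MemLpS F S p f → ∀ (m : ℕ) (g : Ω → ℝ),
    IsGreedyApproxPhi Φ p μ f m g →
      eLpNorm (f - g) (ENNReal.ofReal p) μ ≤ C * bestApprox (Set.range Φ) p μ f m

/-- `Φ` is a local orthonormal system: it is orthonormal in `L²(μ)` and, for each `k`,
`Φ k` lies in the range of `P_{lvl k} - P_{lvl k - 1}`, i.e. it is piecewise in `S` on the
atoms of `ℱ_{lvl k}` and orthogonal to all functions piecewise in `S` on atoms of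
`ℱ_{lvl k - 1}`. -/
noncomputable def IsLocalONS {μ : Measure Ω} (F : FiltrationAtoms Ω μ)
    (S : Submodule ℝ (Ω → ℝ)) (Φ : ℕ → Ω → ℝ) (lvl : ℕ → ℕ) : Prop :=
  (∀ i j, ∫ ω, Φ i ω * Φ j ω ∂μ = if i = j then 1 else 0) ∧
  (∀ k, PiecewiseS F S (lvl k) (Φ k)) ∧
  (∀ k, 1 ≤ lvl k → ∀ h : Ω → ℝ, PiecewiseS F S (lvl k - 1) h →
    ∫ ω, Φ k ω * h ω ∂μ = 0)

/-- The Bernstein inequality `BI(𝒜, S, p, τ)`: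
`‖g‖_{𝒜_τ^β(L^p(S),Φ)} ≤ C 2^{nβ} ‖g‖_p` for all `n ≥ 1` and `g ∈ Σ_{2^n}^Φ`, where
`β = 1/τ - 1/p`. -/
noncomputable def BernsteinBI {μ : Measure Ω} (F : FiltrationAtoms Ω μ)
    (S : Submodule ℝ (Ω → ℝ)) (Φ : ℕ → Ω → ℝ) (p τ : ℝ) : Prop :=
  ∃ C : ℝ≥0∞, C ≠ ∞ ∧ ∀ n : ℕ, 1 ≤ n → ∀ g ∈ SigmaN (Set.range Φ) (2 ^ n),
    approxNorm (Set.range Φ) p (ENNReal.ofReal τ) (1 / τ - 1 / p) μ g ≤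
      C * (2 : ℝ≥0∞) ^ ((n : ℝ) * (1 / τ - 1 / p)) * eLpNorm g (ENNReal.ofReal p) μ

end

section
variable {Ω : Type} [MeasurableSpace Ω]

/-- `Φ` is the generalized Haar system associated to a binary filtration and
`S = span{1_Ω}`: `Φ 0 = 1`, the system is orthonormal in `L²(μ)`, and for each `n` the
function `Φ (n+1)` is supported on the atom `A` subdivided at step `n+1` and constant on
each of the two atoms `A'`, `A''` into which `A` is split. -/
noncomputable def IsGenHaar {μ : Measure Ω} (F : FiltrationAtoms Ω μ) (Φ : ℕ → Ω → ℝ) :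
    Prop :=
  (∀ i j, ∫ ω, Φ i ω * Φ j ω ∂μ = if i = j then 1 else 0) ∧
  (Φ 0 = fun _ => 1) ∧
  ∀ n : ℕ, ∃ A A' A'' : Set Ω, A ∈ F.atoms n ∧ A' ∈ F.atoms (n + 1) ∧
    A'' ∈ F.atoms (n + 1) ∧ A' ∪ A'' = A ∧ Disjoint A' A'' ∧
    (∀ ω, ω ∉ A → Φ (n + 1) ω = 0) ∧
    (∃ a : ℝ, ∀ ω ∈ A', Φ (n + 1) ω = a) ∧ (∃ b : ℝ, ∀ ω ∈ A'', Φ (n + 1) ω = b)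

/-- Condition `w3(𝒜, p, σ)`: there are `ρ ∈ (0,1)` and `M > 0` such that for every chain
of atoms `X_0 ⊃ X_1 ⊃ ⋯ ⊃ X_n` (each `X_{j+1}` a child of `X_j`) with `|X_n| ≥ ρ|X_0|`,
every partition `{λ_i, …, λ_{i+1}-1}` (`0 = λ_0 < λ_1 < ⋯ < λ_k = n`) of `{0,…,n-1}` into
blocks of consecutive indices, and all subsets `Γ_i ⊆ {λ_i, …, λ_{i+1}-1}`, setting
`R_i = X_{λ_i} \ X_{λ_{i+1}}` and `Q_i = ⋃_{j ∈ Γ_i} X_j \ X_{j+1}`, one has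
`(∑_i min(|Q_i|, |R_i \ Q_i|)^{σ/p})^{1/σ} ≤ M |X_0 \ X_n|^{1/p}`. -/
noncomputable def W3Cond {μ : Measure Ω} (F : FiltrationAtoms Ω μ) (p σ : ℝ) : Prop :=
  ∃ ρ ∈ Set.Ioo (0 : ℝ) 1, ∃ M : ℝ, 0 < M ∧
    ∀ (n : ℕ) (X : ℕ → Set Ω), X 0 ∈ F.Atoms →
      (∀ j < n, F.IsChildOf (X (j + 1)) (X j)) →
      ENNReal.ofReal ρ * μ (X 0) ≤ μ (X n) →
      ∀ (k : ℕ) (lam : ℕ → ℕ), lam 0 = 0 → lam k = n →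
        (∀ i < k, lam i < lam (i + 1)) →
        ∀ Γ : ℕ → Set ℕ, (∀ i, Γ i ⊆ Set.Ico (lam i) (lam (i + 1))) →
        (∑ i ∈ Finset.range k,
            min (μ (⋃ j ∈ Γ i, X j \ X (j + 1)))
                (μ ((X (lam i) \ X (lam (i + 1))) \ ⋃ j ∈ Γ i, X j \ X (j + 1)))
              ^ (σ / p)) ^ (1 / σ)
          ≤ ENNReal.ofReal M * μ (X 0 \ X n) ^ (1 / p)

/-- The counterexample function `f = 1_{X_0 \ X_n} - γ 1_{X_n}` with
`γ = |X_0 \ X_n| / |X_n|` (so that `f` has mean zero). -/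
noncomputable def cexFun (μ : Measure Ω) (R B : Set Ω) : Ω → ℝ :=
  fun ω => R.indicator (fun _ => (1 : ℝ)) ω -
    ((μ R).toReal / (μ B).toReal) * B.indicator (fun _ => (1 : ℝ)) ω

end

/-- The unit interval `[0,1)` as a measurable space. -/
abbrev UnitIco : Type := ↥(Set.Ico (0 : ℝ) 1)

/-- Lebesgue measure on `[0,1)`. -/
noncomputable def vol01 : Measure UnitIco := Measure.comap Subtype.val volume

/-- `S = span{1_Ω}`, the space of constant functions on `[0,1)`. -/
noncomputable def constS : Submodule ℝ (UnitIco → ℝ) :=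
  Submodule.span ℝ {fun _ => (1 : ℝ)}

/-- A point that leaves the chain between `i` and `j` leaves it at a definite step. -/
lemma exists_mem_chain_diff {Ω : Type} {X : ℕ → Set Ω} {i j : ℕ} (hij : i ≤ j) {x : Ω} (hx : x ∈ X i \ X j) :
    ∃ m, i ≤ m ∧ m < j ∧ x ∈ X m \ X (m + 1) := by
  induction j, hij using Nat.le_induction with
  | base => exact absurd hx.1 hx.2
  | succ j hij ih =>
    by_cases hxj : x ∈ X j
    · exact ⟨j, hij, by omega, hxj, hx.2⟩
    · obtain ⟨m, h1, h2, h3⟩ := ih ⟨hx.1, hxj⟩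
      exact ⟨m, h1, by omega, h3⟩

namespace FiltrationAtoms

variable {Ω : Type} [MeasurableSpace Ω] {μ : Measure Ω} {F : FiltrationAtoms Ω μ}

lemma nonempty_of_mem_atoms {n : ℕ} {A : Set Ω} (hA : A ∈ F.atoms n) : A.Nonempty :=
  nonempty_of_measure_ne_zero (F.atoms_pos n A hA).ne'

lemma eq_of_mem_atoms_of_inter {n : ℕ} {A B : Set Ω} (hA : A ∈ F.atoms n)
    (hB : B ∈ F.atoms n) (h : (A ∩ B).Nonempty) : A = B := by
  by_contra hne
  exact (not_disjoint_iff_nonempty_inter.2 h) (F.atoms_disjoint n hA hB hne)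

lemma exists_superset_atom {k l : ℕ} (hkl : k ≤ l) {B : Set Ω} (hB : B ∈ F.atoms l) :
    ∃ A ∈ F.atoms k, B ⊆ A := by
  induction l, hkl using Nat.le_induction generalizing B with
  | base => exact ⟨B, hB, subset_rfl⟩
  | succ l _ ih =>
    obtain ⟨A, hA, hBA⟩ := F.atoms_refine l B hB
    obtain ⟨A', hA', hAA'⟩ := ih hA
    exact ⟨A', hA', hBA.trans hAA'⟩

lemma subset_of_mem_atoms_of_inter {k l : ℕ} (hkl : k ≤ l) {A B : Set Ω}
    (hA : A ∈ F.atoms k) (hB : B ∈ F.atoms l) (h : (A ∩ B).Nonempty) : B ⊆ A := by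
  obtain ⟨A', hA', hBA'⟩ := F.exists_superset_atom hkl hB
  rwa [F.eq_of_mem_atoms_of_inter hA hA' (h.mono (inter_subset_inter_right A hBA'))]

/-- Two atoms that meet are nested. -/
lemma nested_of_inter {A B : Set Ω} (hA : A ∈ F.Atoms) (hB : B ∈ F.Atoms)
    (h : (A ∩ B).Nonempty) : A ⊆ B ∨ B ⊆ A := by
  obtain ⟨k, hA⟩ := mem_iUnion.1 hA
  obtain ⟨l, hB⟩ := mem_iUnion.1 hB
  rcases le_total k l with hkl | hkl
  · exact Or.inr (F.subset_of_mem_atoms_of_inter hkl hA hB h)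
  · exact Or.inl (F.subset_of_mem_atoms_of_inter hkl hB hA (inter_comm A B ▸ h))

lemma measurableSet_of_mem_Atoms {A : Set Ω} (hA : A ∈ F.Atoms) : MeasurableSet A := by
  obtain ⟨k, hA⟩ := mem_iUnion.1 hA
  exact F.atoms_measurable k A hA

lemma measure_pos_of_mem_Atoms {A : Set Ω} (hA : A ∈ F.Atoms) : 0 < μ A := by
  obtain ⟨k, hA⟩ := mem_iUnion.1 hA
  exact F.atoms_pos k A hA

lemma nonempty_of_mem_Atoms {A : Set Ω} (hA : A ∈ F.Atoms) : A.Nonempty :=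
  nonempty_of_measure_ne_zero (F.measure_pos_of_mem_Atoms hA).ne'

lemma IsChildOf.mem_Atoms {A B : Set Ω} (h : F.IsChildOf B A) : B ∈ F.Atoms := by
  obtain ⟨m, -, hB, -⟩ := h
  exact mem_iUnion.2 ⟨_, hB⟩

lemma IsChildOf.ssubset {A B : Set Ω} (h : F.IsChildOf B A) : B ⊂ A := by
  obtain ⟨m, -, -, hBA⟩ := h
  exact hBA

/-- There is no atom strictly between an atom and its child. -/
lemma IsChildOf.subset_or_subset {A B D : Set Ω} (h : F.IsChildOf B A) (hD : D ∈ F.Atoms)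
    (hDB : (D ∩ B).Nonempty) : A ⊆ D ∨ D ⊆ B := by
  obtain ⟨m, hA, hB, hBA⟩ := h
  obtain ⟨k, hD⟩ := mem_iUnion.1 hD
  rcases le_or_gt k m with hkm | hkm
  · exact Or.inl (F.subset_of_mem_atoms_of_inter hkm hD hA
      (hDB.mono (inter_subset_inter_right D hBA.1)))
  · exact Or.inr (F.subset_of_mem_atoms_of_inter hkm hB hD (inter_comm D B ▸ hDB))

/-- In a binary filtration only one atom is subdivided at each step. -/
lemma IsBinary.eq_of_ssubset (hbin : F.IsBinary) {m : ℕ} {A B A' B' : Set Ω}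
    (hA : A ∈ F.atoms m) (hB : B ∈ F.atoms m) (hA' : A' ∈ F.atoms (m + 1))
    (hB' : B' ∈ F.atoms (m + 1)) (hAA' : A' ⊂ A) (hBB' : B' ⊂ B) : A = B := by
  obtain ⟨D, hD, D', D'', -, -, -, hDu, -, -, hm⟩ := hbin m
  have key : ∀ {E E' : Set Ω}, E ∈ F.atoms m → E' ∈ F.atoms (m + 1) → E' ⊂ E → E = D := by
    intro E E' hE hE' hEE'
    obtain ⟨x, hx⟩ := F.nonempty_of_mem_atoms hE'
    have hxE := hEE'.1 hx
    rw [hm] at hE'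
    rcases hE' with rfl | rfl | ⟨hE', -⟩
    · exact F.eq_of_mem_atoms_of_inter hE hD ⟨x, hxE, hDu ▸ Or.inl hx⟩
    · exact F.eq_of_mem_atoms_of_inter hE hD ⟨x, hxE, hDu ▸ Or.inr hx⟩
    · exact absurd (F.eq_of_mem_atoms_of_inter hE' hE ⟨x, hx, hxE⟩) hEE'.ne
  rw [key hA hA' hAA', key hB hB' hBB']

section Chain

variable {n : ℕ} {X : ℕ → Set Ω}

lemma chain_subset (hX : ∀ j < n, F.IsChildOf (X (j + 1)) (X j)) {i j : ℕ} (hij : i ≤ j)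
    (hj : j ≤ n) : X j ⊆ X i := by
  induction j, hij using Nat.le_induction with
  | base => exact subset_rfl
  | succ j _ ih => exact (hX j hj).ssubset.1.trans (ih (by omega))

lemma chain_ssubset (hX : ∀ j < n, F.IsChildOf (X (j + 1)) (X j)) {i j : ℕ} (hij : i < j)
    (hj : j ≤ n) : X j ⊂ X i :=
  (chain_subset hX hij hj).trans_ssubset (hX i (by omega)).ssubset

lemma chain_mem_Atoms (h0 : X 0 ∈ F.Atoms) (hX : ∀ j < n, F.IsChildOf (X (j + 1)) (X j))
    {j : ℕ} (hj : j ≤ n) : X j ∈ F.Atoms := by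
  cases j with
  | zero => exact h0
  | succ j => exact (hX j hj).mem_Atoms

/-- An atom or ring lies in one of the three pieces determined by `X (n + 1) ⊆ X 0`, unless it
contains one of three fixed sets. -/
lemma IsAtomOrRing.const_or_subset (h0 : X 0 ∈ F.Atoms)
    (hX : ∀ j < n + 1, F.IsChildOf (X (j + 1)) (X j)) {R : Set Ω} (hR : F.IsAtomOrRing R) :
    (Disjoint R (X 0) ∨ R ⊆ X 0 \ X (n + 1) ∨ R ⊆ X (n + 1)) ∨
      X (n + 1) ⊆ R ∨ X n \ X (n + 1) ⊆ R ∨ X 0 \ X 1 ⊆ R := by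
  obtain ⟨A, hA, B, hB, rfl⟩ : ∃ A ∈ F.Atoms, ∃ B, (B = ∅ ∨ B ∈ F.Atoms) ∧ R = A \ B := by
    rcases hR with hR | ⟨A, hA, B, hB, -, rfl, -⟩
    · exact ⟨R, hR, ∅, Or.inl rfl, sdiff_empty.symm⟩
    · exact ⟨A, hA, B, Or.inr hB, rfl⟩
  have hn0 : X (n + 1) ⊆ X 0 := chain_subset hX (Nat.zero_le _) le_rfl
  have hnA := chain_mem_Atoms h0 hX le_rfl
  by_cases hA0 : (A ∩ X 0).Nonempty
  swap
  · exact Or.inl (Or.inl ((disjoint_iff_inter_eq_empty.2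
      (not_nonempty_iff_eq_empty.1 hA0)).mono_left sdiff_subset))
  by_cases hAn : (A ∩ X (n + 1)).Nonempty
  swap
  · rcases F.nested_of_inter hA h0 hA0 with h | h
    · exact Or.inl (Or.inr (Or.inl fun x hx => ⟨h hx.1, fun hxn => hAn ⟨x, hx.1, hxn⟩⟩))
    · obtain ⟨x, hx⟩ := F.nonempty_of_mem_Atoms hnA
      exact absurd ⟨x, h (hn0 hx), hx⟩ hAn
  rcases (hX n (by omega)).subset_or_subset hA hAn with hAn' | hAn'
  swap
  · exact Or.inl (Or.inr (Or.inr (sdiff_subset.trans hAn')))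
  have hnn : X (n + 1) ⊆ X n := (hX n (by omega)).ssubset.1
  by_cases hBn : (B ∩ X (n + 1)).Nonempty
  swap
  · exact Or.inr (Or.inl fun x hx => ⟨hAn' (hnn hx), fun hxB => hBn ⟨x, hxB, hx⟩⟩)
  have hB : B ∈ F.Atoms := hB.resolve_left (by rintro rfl; simp at hBn)
  rcases (hX n (by omega)).subset_or_subset hB hBn with hBn' | hBn'
  swap
  · exact Or.inr (Or.inr (Or.inl fun x hx => ⟨hAn' hx.1, fun hxB => hx.2 (hBn' hxB)⟩))
  have hB1 : (B ∩ X 1).Nonempty :=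
    hBn.mono (inter_subset_inter_right B (chain_subset hX (by omega) le_rfl))
  rcases (hX 0 (by omega)).subset_or_subset hB hB1 with hB0 | hB0
  · exact Or.inl (Or.inl (disjoint_left.2 fun x hx hx0 => hx.2 (hB0 hx0)))
  rcases F.nested_of_inter hA h0 hA0 with h | h
  · exact Or.inl (Or.inr (Or.inl fun x hx => ⟨h hx.1, fun hxn => hx.2 (hBn' (hnn hxn))⟩))
  · exact Or.inr (Or.inr (Or.inr fun x hx => ⟨h hx.1, fun hxB => hx.2 (hB0 hxB)⟩))

/-- Among pairwise disjoint atoms or rings, at most three are not contained in one of the three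
pieces determined by `X (n + 1) ⊆ X 0`. -/
lemma card_filter_not_const_le (h0 : X 0 ∈ F.Atoms)
    (hX : ∀ j < n + 1, F.IsChildOf (X (j + 1)) (X j)) (P : Finset (Set Ω))
    (hP : ∀ R ∈ P, F.IsAtomOrRing R) (hPd : (↑P : Set (Set Ω)).Pairwise Disjoint) :
    (P.filter fun R => ¬ (Disjoint R (X 0) ∨ R ⊆ X 0 \ X (n + 1) ∨ R ⊆ X (n + 1))).card ≤ 3 := by
  let Y : Fin 3 → Set Ω := ![X (n + 1), X n \ X (n + 1), X 0 \ X 1]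
  have hY : ∀ i, (Y i).Nonempty := by
    intro i
    fin_cases i
    · exact F.nonempty_of_mem_Atoms (chain_mem_Atoms h0 hX le_rfl)
    · exact nonempty_of_ssubset (hX n (by omega)).ssubset
    · exact nonempty_of_ssubset (hX 0 (by omega)).ssubset
  have hex : ∀ R ∈ P.filter fun R =>
      ¬ (Disjoint R (X 0) ∨ R ⊆ X 0 \ X (n + 1) ∨ R ⊆ X (n + 1)), ∃ i, Y i ⊆ R := by
    intro R hR
    rw [Finset.mem_filter] at hR
    rcases ((hP R hR.1).const_or_subset h0 hX).resolve_left hR.2 with h | h | h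
    · exact ⟨0, h⟩
    · exact ⟨1, h⟩
    · exact ⟨2, h⟩
  choose! τ hτ using hex
  have := Finset.card_le_card_of_injOn (t := Finset.univ) τ (fun _ _ => Finset.mem_univ _)
    (s := P.filter fun R =>
      ¬ (Disjoint R (X 0) ∨ R ⊆ X 0 \ X (n + 1) ∨ R ⊆ X (n + 1))) (by
    intro R hR R' hR' hRR'
    by_contra hne
    obtain ⟨x, hx⟩ := hY (τ R)
    exact disjoint_left.1 (hPd (Finset.mem_filter.1 hR).1 (Finset.mem_filter.1 hR').1 hne)
      (hτ R hR hx) (hτ R' hR' (hRR' ▸ hx)))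
  simpa using this

end Chain

end FiltrationAtoms

section Haar

variable {Ω : Type} [MeasurableSpace Ω] {μ : Measure Ω} {F : FiltrationAtoms Ω μ}

/-- Explicit values of the generalized Haar function attached to the subdivision of `A`
into `B` and `A \ B`. -/
lemma IsGenHaar.exists_index [IsFiniteMeasure μ] {Φ : ℕ → Ω → ℝ} (hΦ : IsGenHaar F Φ)
    (hbin : F.IsBinary) {A B : Set Ω} (h : F.IsChildOf B A) :
    ∃ m, A ∈ F.atoms m ∧ B ∈ F.atoms (m + 1) ∧ ∃ a b : ℝ,
      (∀ x, x ∉ A → Φ (m + 1) x = 0) ∧ (∀ x ∈ A \ B, Φ (m + 1) x = a) ∧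
      (∀ x ∈ B, Φ (m + 1) x = b) ∧ a * μ.real (A \ B) + b * μ.real B = 0 ∧
      b ^ 2 = (μ.real B)⁻¹ - (μ.real A)⁻¹ ∧ a * b = -(μ.real A)⁻¹ ∧ b ≠ 0 := by
  obtain ⟨m, hA, hB, hBA⟩ := h
  obtain ⟨horth, hone, hsplit⟩ := hΦ
  obtain ⟨E, E', E'', hE, hE', hE'', hu, hd, hz, ⟨a', ha'⟩, ⟨b', hb'⟩⟩ := hsplit m
  have hE'E : E' ⊂ E := by
    refine ⟨hu ▸ subset_union_left, fun hsub => ?_⟩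
    obtain ⟨x, hx⟩ := F.nonempty_of_mem_atoms hE''
    exact disjoint_left.1 hd (hsub (hu ▸ Or.inr hx)) hx
  obtain rfl : A = E := hbin.eq_of_ssubset hA hE hB hE' hBA hE'E
  have hval : ∃ a b : ℝ, (∀ x ∈ A \ B, Φ (m + 1) x = a) ∧ (∀ x ∈ B, Φ (m + 1) x = b) := by
    obtain ⟨x, hx⟩ := F.nonempty_of_mem_atoms hB
    have hxA : x ∈ E' ∪ E'' := hu ▸ hBA.1 hx
    rcases hxA with hxE | hxE
    · obtain rfl := F.eq_of_mem_atoms_of_inter hB hE' ⟨x, hx, hxE⟩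
      refine ⟨b', a', fun y hy => hb' y ?_, ha'⟩
      rw [← hu] at hy
      exact hy.1.resolve_left hy.2
    · obtain rfl := F.eq_of_mem_atoms_of_inter hB hE'' ⟨x, hx, hxE⟩
      refine ⟨a', b', fun y hy => ha' y ?_, hb'⟩
      rw [← hu] at hy
      exact hy.1.resolve_right hy.2
  obtain ⟨a, b, ha, hb⟩ := hval
  have hAm := F.atoms_measurable m A hA
  have hBm := F.atoms_measurable (m + 1) B hB
  have hint : ∀ (c d : ℝ), ∫ x, ((A \ B).indicator (fun _ => c) x + B.indicator (fun _ => d) x) ∂μ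
      = c * μ.real (A \ B) + d * μ.real B := by
    intro c d
    rw [integral_add ((integrable_const c).indicator (hAm.diff hBm))
      ((integrable_const d).indicator hBm), integral_indicator_const c (hAm.diff hBm),
      integral_indicator_const d hBm]
    simp [mul_comm]
  have hΦeq : ∀ x, Φ (m + 1) x =
      (A \ B).indicator (fun _ => a) x + B.indicator (fun _ => b) x := by
    intro x
    by_cases hxB : x ∈ B
    · simp [hxB, hb x hxB]
    · by_cases hxA : x ∈ A
      · simp [hxA, hxB, ha x ⟨hxA, hxB⟩]
      · simp [hxA, hxB, hz x hxA]
  have h1 : a * μ.real (A \ B) + b * μ.real B = 0 := by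
    have := horth 0 (m + 1)
    rw [if_neg (by omega), hone] at this
    rw [← hint, ← this]
    simp only [hΦeq, one_mul]
  have h2 : a ^ 2 * μ.real (A \ B) + b ^ 2 * μ.real B = 1 := by
    have := horth (m + 1) (m + 1)
    rw [if_pos rfl] at this
    rw [← hint, ← this]
    congr 1
    ext x
    rw [hΦeq]
    by_cases hxB : x ∈ B
    · simp [hxB, sq]
    · by_cases hxA : x ∈ A <;> simp [hxA, hxB, sq]
  have hBpos : 0 < μ.real B := ENNReal.toReal_pos (F.atoms_pos _ B hB).ne' (measure_ne_top _ _)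
  have hAB : μ.real A = μ.real (A \ B) + μ.real B := by
    rw [measureReal_sdiff hBA.1 hBm]; ring
  have hDnn : 0 ≤ μ.real (A \ B) := measureReal_nonneg
  set D := μ.real (A \ B)
  set β := μ.real B
  have hDpos : 0 < D := by
    rcases hDnn.eq_or_lt with h | h
    · rw [← h] at h1 h2
      have : b = 0 := by
        have : b * β = 0 := by linarith
        exact (mul_eq_zero.1 this).resolve_right hBpos.ne'
      simp [this] at h2
    · exact h
  have ha1 : a = -(b * β) / D := by field_simp; linarith
  have hb2 : b ^ 2 * (β * (D + β)) = D := by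
    rw [ha1] at h2
    field_simp at h2
    nlinarith [h2]
  refine ⟨m, hA, hB, a, b, hz, ha, hb, h1, ?_, ?_, ?_⟩
  · rw [hAB]; field_simp; linarith
  · rw [hAB, ha1]; field_simp; nlinarith
  · rintro rfl
    simp at hb2
    exact hDpos.ne hb2

/-- The Haar coefficient of the counterexample function at a step of the chain. -/
lemma expansionCoef_cexFun [IsFiniteMeasure μ] {Φ : ℕ → Ω → ℝ} {ℓ : ℕ} {X₀ A B Y : Set Ω}
    (hA : MeasurableSet A) (hB : MeasurableSet B) (hY : MeasurableSet Y) (hYpos : μ Y ≠ 0)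
    (hYB : Y ⊆ B) (hBA : B ⊆ A) (hAX : A ⊆ X₀) {a b : ℝ}
    (hz : ∀ x, x ∉ A → Φ ℓ x = 0) (ha : ∀ x ∈ A \ B, Φ ℓ x = a) (hb : ∀ x ∈ B, Φ ℓ x = b)
    (hab : a * μ.real (A \ B) + b * μ.real B = 0) :
    ExpansionCoef Φ μ (cexFun μ (X₀ \ Y) Y) ℓ = -(b * μ.real X₀) := by
  have hYX : Y ⊆ X₀ := hYB.trans (hBA.trans hAX)
  set γ := (μ (X₀ \ Y)).toReal / (μ Y).toReal with hγ
  have heq : ∀ x, cexFun μ (X₀ \ Y) Y x * Φ ℓ x =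
      (A \ B).indicator (fun _ => a) x + (B \ Y).indicator (fun _ => b) x +
        Y.indicator (fun _ => -(γ * b)) x := by
    intro x
    simp only [cexFun, ← hγ]
    by_cases hxA : x ∈ A
    swap
    · have hxB : x ∉ B := fun h => hxA (hBA h)
      have hxY : x ∉ Y := fun h => hxB (hYB h)
      simp [hxA, hxB, hxY, hz x hxA]
    have hxX := hAX hxA
    by_cases hxB : x ∈ B
    swap
    · have hxY : x ∉ Y := fun h => hxB (hYB h)
      simp [hxA, hxB, hxY, hxX, ha x ⟨hxA, hxB⟩]
    by_cases hxY : x ∈ Y <;> simp [hxB, hxY, hxX, hb x hxB]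
  have hI := fun {s : Set Ω} (hs : MeasurableSet s) (c : ℝ) =>
    (integrable_const (μ := μ) c).indicator hs
  have hYr : (μ Y).toReal ≠ 0 := (ENNReal.toReal_pos hYpos (measure_ne_top _ _)).ne'
  rw [ExpansionCoef]
  simp only [heq]
  have hI2 : Integrable (fun x => (A \ B).indicator (fun _ => a) x +
      (B \ Y).indicator (fun _ => b) x) μ := (hI (hA.diff hB) a).add (hI (hB.diff hY) b)
  rw [integral_add hI2 (hI hY _), integral_add (hI (hA.diff hB) a) (hI (hB.diff hY) b),
    integral_indicator_const _ (hA.diff hB), integral_indicator_const _ (hB.diff hY),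
    integral_indicator_const _ hY, measureReal_sdiff hYB hY]
  have hγ' : γ * μ.real Y = μ.real X₀ - μ.real Y := by
    rw [hγ, ← measureReal_sdiff hYX hY]
    exact div_mul_cancel₀ _ hYr
  simp only [smul_eq_mul]
  linear_combination hab - b * hγ'

end Haar

/-- Pointwise bounds at a point leaving a chain at step `m`, for partial sums of terms whose
values telescope along the chain. -/
lemma sum_telescope_bounds {G : Finset ℕ} {m : ℕ} {u t : ℕ → ℝ} (hu : Monotone fun j => u (min j m))
    (hlt : ∀ j < m, t j = u j - u (j + 1)) (hm : t m = u m) (hgt : ∀ j ∈ G, m < j → t j = 0) :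
    (m ∈ G → u 0 ≤ ∑ j ∈ G, t j) ∧ (m ∉ G → ∑ j ∈ G, t j ≤ 0) := by
  have hnonpos : ∀ j < m, t j ≤ 0 := by
    intro j hj
    have := hu (Nat.le_succ j)
    simp only [Nat.succ_eq_add_one, min_eq_left hj.le, min_eq_left (Nat.succ_le_of_lt hj)] at this
    rw [hlt j hj]; linarith
  constructor
  · intro hmG
    calc u 0 = ∑ j ∈ Finset.range (m + 1), t j := by
          rw [Finset.sum_range_succ, hm,
            Finset.sum_congr rfl fun j hj => hlt j (Finset.mem_range.1 hj),
            Finset.sum_range_sub']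
          ring
      _ ≤ ∑ j ∈ (Finset.range (m + 1)).filter (· ∈ G), t j := by
          rw [Finset.sum_filter]
          refine Finset.sum_le_sum fun j hj => ?_
          split_ifs with hjG
          · exact le_rfl
          · refine hnonpos j (lt_of_le_of_ne (Nat.lt_succ_iff.1 (Finset.mem_range.1 hj)) ?_)
            rintro rfl
            exact hjG hmG
      _ = ∑ j ∈ G, t j := by
          refine Finset.sum_subset (fun j hj => (Finset.mem_filter.1 hj).2) fun j hj hj' => ?_
          refine hgt j hj ?_
          by_contra hle
          exact hj' (Finset.mem_filter.2 ⟨Finset.mem_range.2 (by omega), hj⟩)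
  · intro hmG
    refine Finset.sum_nonpos fun j hj => ?_
    rcases lt_trichotomy j m with h | rfl | h
    · exact hnonpos j h
    · exact absurd hj hmG
    · exact (hgt j hj h).le

instance isFiniteMeasure_vol01 : IsFiniteMeasure vol01 := by
  refine ⟨?_⟩
  rw [vol01, Measure.comap_apply _ Subtype.val_injective
    (fun s hs => (MeasurableEmbedding.subtype_coe measurableSet_Ico).measurableSet_image.2 hs) _
    MeasurableSet.univ, image_univ, Subtype.range_coe, Real.volume_Ico]
  exact ENNReal.ofReal_lt_top

lemma Ep_constS_le {μ : Measure UnitIco} (p : ℝ) (f : UnitIco → ℝ) (R : Set UnitIco) :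
    Ep constS p μ f R ≤ eLpNorm f (ENNReal.ofReal p) μ := by
  refine (iInf₂_le 0 (zero_mem _)).trans ?_
  rw [sub_zero]
  exact eLpNorm_restrict_le _ _ _ _

lemma Ep_constS_eq_zero {μ : Measure UnitIco} (p : ℝ) {f : UnitIco → ℝ} {R : Set UnitIco}
    (hR : MeasurableSet R) {c : ℝ} (hf : ∀ x ∈ R, f x = c) : Ep constS p μ f R = 0 := by
  refine le_antisymm ?_ zero_le
  refine (iInf₂_le (fun _ => c) ?_).trans ?_
  · exact Submodule.mem_span_singleton.2 ⟨c, by ext; simp⟩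
  · refine (eLpNorm_congr_ae (g := 0) ?_).trans_le (by simp)
    filter_upwards [ae_restrict_mem hR] with x hx
    simp [hf x hx]

/-- A function that is at least `1` on `Q` and at most `0` on `R \ Q` is far from constants. -/
lemma half_min_le_Ep_constS {μ : Measure UnitIco} {p : ℝ} (hp : 0 < p) {g : UnitIco → ℝ}
    {R Q : Set UnitIco} (hR : MeasurableSet R) (hQ : MeasurableSet Q) (hQR : Q ⊆ R)
    (h1 : ∀ x ∈ Q, 1 ≤ g x) (h0 : ∀ x ∈ R \ Q, g x ≤ 0) :
    ENNReal.ofReal (1 / 2) * min (μ Q) (μ (R \ Q)) ^ (1 / p) ≤ Ep constS p μ g R := by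
  refine le_iInf₂ fun h hh => ?_
  obtain ⟨c, rfl⟩ := Submodule.mem_span_singleton.1 hh
  have key : ∀ T : Set UnitIco, MeasurableSet T → T ⊆ R → (∀ x ∈ T, 1 / 2 ≤ |g x - c|) →
      ENNReal.ofReal (1 / 2) * μ T ^ (1 / p) ≤
        eLpNorm (g - c • fun _ => (1 : ℝ)) (ENNReal.ofReal p) (μ.restrict R) := by
    intro T hT hTR hg
    have hpT : (ENNReal.ofReal p) ≠ 0 := by simpa using hp
    have := eLpNorm_indicator_const (μ := μ.restrict R) (c := (1 / 2 : ℝ)) hT hpT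
      ENNReal.ofReal_ne_top
    rw [Measure.restrict_apply hT, inter_eq_left.2 hTR, ENNReal.toReal_ofReal hp.le,
      Real.enorm_eq_ofReal (by norm_num)] at this
    rw [← this]
    refine eLpNorm_mono fun x => ?_
    by_cases hx : x ∈ T
    · have := hg x hx
      simp only [indicator_of_mem hx, Pi.sub_apply, Pi.smul_apply, smul_eq_mul, mul_one,
        Real.norm_eq_abs]
      rwa [abs_of_pos (by norm_num : (0 : ℝ) < 1 / 2)]
    · simp [hx]
  rcases le_total c (1 / 2) with hc | hc
  · refine le_trans ?_ (key Q hQ hQR fun x hx => ?_)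
    · gcongr
      exact min_le_left _ _
    · exact le_trans (by linarith [h1 x hx]) (le_abs_self _)
  · refine le_trans ?_ (key (R \ Q) (hR.diff hQ) sdiff_subset fun x hx => ?_)
    · gcongr
      exact min_le_right _ _
    · exact le_trans (by linarith [h0 x hx]) (neg_le_abs _)

lemma eLpNorm_cexFun_le {Ω : Type} [MeasurableSpace Ω] {μ : Measure Ω} [IsFiniteMeasure μ] {p : ℝ}
    (hp : 1 < p) {R B : Set Ω} (hR : MeasurableSet R) (hB : MeasurableSet B) (hB0 : μ B ≠ 0)
    (hRB : μ R ≤ μ B) :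
    eLpNorm (cexFun μ R B) (ENNReal.ofReal p) μ ≤ 2 * μ R ^ (1 / p) := by
  have hp0 : 0 < p := by linarith
  have hpT : (ENNReal.ofReal p) ≠ 0 := by simpa using hp0
  set γ := (μ R).toReal / (μ B).toReal with hγ
  have hγ0 : 0 ≤ γ := by positivity
  have hfun : cexFun μ R B = R.indicator (fun _ => (1 : ℝ)) - B.indicator (fun _ => γ) := by
    ext x
    by_cases hx : x ∈ B <;> simp [cexFun, hx, hγ]
  have hγe : ENNReal.ofReal γ = μ R / μ B := by
    rw [hγ, ← ENNReal.toReal_div, ENNReal.ofReal_toReal]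
    exact (ENNReal.div_lt_top (measure_ne_top _ _) hB0).ne
  have hγ1 : μ R / μ B ≤ 1 := ENNReal.div_le_of_le_mul (by simpa using hRB)
  rw [hfun, two_mul]
  refine (eLpNorm_sub_le ((measurable_const.indicator hR).aestronglyMeasurable)
    ((measurable_const.indicator hB).aestronglyMeasurable)
    (by rw [← ENNReal.ofReal_one]; exact ENNReal.ofReal_le_ofReal hp.le)).trans ?_
  rw [eLpNorm_indicator_const hR hpT ENNReal.ofReal_ne_top,
    eLpNorm_indicator_const hB hpT ENNReal.ofReal_ne_top, ENNReal.toReal_ofReal hp0.le,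
    Real.enorm_eq_ofReal hγ0, hγe]
  refine add_le_add (by simp) ?_
  calc μ R / μ B * μ B ^ (1 / p) ≤ (μ R / μ B) ^ (1 / p) * μ B ^ (1 / p) := by
        gcongr
        conv_lhs => rw [← ENNReal.rpow_one (μ R / μ B)]
        exact ENNReal.rpow_le_rpow_of_exponent_ge hγ1 (by rw [div_le_one hp0]; exact hp.le)
    _ = μ R ^ (1 / p) := by
        rw [← ENNReal.mul_rpow_of_nonneg _ _ (by positivity),
          ENNReal.div_mul_cancel hB0 (measure_ne_top _ _)]

lemma varNorm_cexFun_le {F : FiltrationAtoms UnitIco vol01} {p σ : ℝ} (hp : 1 < p) (hσ : 0 < σ)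
    {n : ℕ} {X : ℕ → Set UnitIco} (h0 : X 0 ∈ F.Atoms)
    (hX : ∀ j < n + 1, F.IsChildOf (X (j + 1)) (X j))
    (hhalf : vol01 (X 0 \ X (n + 1)) ≤ vol01 (X (n + 1))) :
    varNorm F constS σ p (cexFun vol01 (X 0 \ X (n + 1)) (X (n + 1))) ≤
      (1 + 3 ^ (1 / σ)) * (2 * vol01 (X 0 \ X (n + 1)) ^ (1 / p)) := by
  have hnA := FiltrationAtoms.chain_mem_Atoms h0 hX le_rfl
  have hn0 : X (n + 1) ⊆ X 0 := FiltrationAtoms.chain_subset hX (Nat.zero_le _) le_rfl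
  have hle := eLpNorm_cexFun_le hp
    ((F.measurableSet_of_mem_Atoms h0).diff (F.measurableSet_of_mem_Atoms hnA))
    (F.measurableSet_of_mem_Atoms hnA) (F.measure_pos_of_mem_Atoms hnA).ne' hhalf
  set f := cexFun vol01 (X 0 \ X (n + 1)) (X (n + 1)) with hf
  refine le_trans ?_ (mul_le_mul_right hle _)
  rw [varNorm, add_mul, one_mul]
  gcongr
  refine iSup₂_le fun P hP => iSup_le fun hPd => ?_
  have hcard := FiltrationAtoms.card_filter_not_const_le h0 hX P hP hPd
  have hsum : ∑ R ∈ P, Ep constS p vol01 f R ^ σ ≤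
      3 * eLpNorm f (ENNReal.ofReal p) vol01 ^ σ := by
    rw [← Finset.sum_filter_add_sum_filter_not P
      (fun R => Disjoint R (X 0) ∨ R ⊆ X 0 \ X (n + 1) ∨ R ⊆ X (n + 1)),
      Finset.sum_eq_zero, zero_add]
    · calc _ ≤ ∑ R ∈ P.filter fun R =>
              ¬ (Disjoint R (X 0) ∨ R ⊆ X 0 \ X (n + 1) ∨ R ⊆ X (n + 1)),
              eLpNorm f (ENNReal.ofReal p) vol01 ^ σ :=
            Finset.sum_le_sum fun R _ => ENNReal.rpow_le_rpow (Ep_constS_le p f R) hσ.le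
        _ ≤ _ := by
            rw [Finset.sum_const, nsmul_eq_mul]
            gcongr
            exact_mod_cast hcard
    · intro R hR
      obtain ⟨hRP, hR⟩ := Finset.mem_filter.1 hR
      have hRm : MeasurableSet R := by
        rcases hP R hRP with h | ⟨A, hA, B, hB, -, rfl, -⟩
        · exact F.measurableSet_of_mem_Atoms h
        · exact (F.measurableSet_of_mem_Atoms hA).diff (F.measurableSet_of_mem_Atoms hB)
      obtain ⟨c, hc⟩ : ∃ c, ∀ x ∈ R, f x = c := by
        rcases hR with h | h | h
        · refine ⟨0, fun x hx => ?_⟩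
          have h1 : x ∉ X 0 := disjoint_left.1 h hx
          have h2 : x ∉ X (n + 1) := fun h => h1 (hn0 h)
          simp [hf, cexFun, h1, h2]
        · refine ⟨1, fun x hx => ?_⟩
          simp [hf, cexFun, (h hx).1, (h hx).2]
        · exact ⟨_, fun x hx => by simp [hf, cexFun, h hx]; rfl⟩
      rw [Ep_constS_eq_zero p hRm hc, ENNReal.zero_rpow_of_pos hσ]
  calc _ ≤ (3 * eLpNorm f (ENNReal.ofReal p) vol01 ^ σ) ^ (1 / σ) :=
        ENNReal.rpow_le_rpow hsum (by positivity)
    _ = _ := by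
        rw [ENNReal.mul_rpow_of_nonneg _ _ (by positivity), ← ENNReal.rpow_mul,
          mul_one_div_cancel hσ.ne', ENNReal.rpow_one]

/-- Lower bound for the variation of a function which on each ring of a partition of a chain
oscillates between values `≥ 1` and values `≤ 0`. -/
lemma half_sum_le_varSeminorm {F : FiltrationAtoms UnitIco vol01} {p σ : ℝ} (hp : 0 < p)
    (hσ : 0 < σ) {k : ℕ} {R Q : ℕ → Set UnitIco} (hR : ∀ i < k, F.IsAtomOrRing (R i))
    (hRm : ∀ i < k, MeasurableSet (R i)) (hRne : ∀ i < k, (R i).Nonempty)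
    (hRd : ∀ i < k, ∀ i' < k, i ≠ i' → Disjoint (R i) (R i'))
    (hQm : ∀ i < k, MeasurableSet (Q i)) (hQR : ∀ i < k, Q i ⊆ R i) {g : UnitIco → ℝ}
    (h1 : ∀ i < k, ∀ x ∈ Q i, 1 ≤ g x) (h0 : ∀ i < k, ∀ x ∈ R i \ Q i, g x ≤ 0) :
    ENNReal.ofReal (1 / 2) * (∑ i ∈ Finset.range k,
      min (vol01 (Q i)) (vol01 (R i \ Q i)) ^ (σ / p)) ^ (1 / σ) ≤ varSeminorm F constS σ p g := by
  have hinj : Set.InjOn R (Finset.range k) := by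
    intro i hi i' hi' hii'
    by_contra hne
    have hd := hRd i (by simpa using hi) i' (by simpa using hi') hne
    rw [← hii', disjoint_self] at hd
    exact (hRne i (by simpa using hi)).ne_empty hd
  have hP : ∀ S ∈ (Finset.range k).image R, F.IsAtomOrRing S := by
    intro S hS
    obtain ⟨i, hi, rfl⟩ := Finset.mem_image.1 hS
    exact hR i (Finset.mem_range.1 hi)
  have hPd : (↑((Finset.range k).image R) : Set (Set UnitIco)).Pairwise Disjoint := by
    intro S hS S' hS' hne
    obtain ⟨i, hi, rfl⟩ := Finset.mem_image.1 (Finset.mem_coe.1 hS)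
    obtain ⟨i', hi', rfl⟩ := Finset.mem_image.1 (Finset.mem_coe.1 hS')
    exact hRd i (Finset.mem_range.1 hi) i' (Finset.mem_range.1 hi') fun h => hne (h ▸ rfl)
  refine le_trans ?_ (le_iSup₂_of_le ((Finset.range k).image R) hP (le_iSup_of_le hPd le_rfl))
  rw [Finset.sum_image hinj]
  have hhalf : ENNReal.ofReal (1 / 2) = (ENNReal.ofReal (1 / 2) ^ σ) ^ (1 / σ) := by
    rw [← ENNReal.rpow_mul, mul_one_div_cancel hσ.ne', ENNReal.rpow_one]
  rw [hhalf, ← ENNReal.mul_rpow_of_nonneg _ _ (by positivity), Finset.mul_sum]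
  refine ENNReal.rpow_le_rpow (Finset.sum_le_sum fun i hi => ?_) (by positivity)
  have hi := Finset.mem_range.1 hi
  refine le_trans (le_of_eq ?_) (ENNReal.rpow_le_rpow
    (half_min_le_Ep_constS hp (hRm i hi) (hQm i hi) (hQR i hi) (h1 i hi) (h0 i hi)) hσ.le)
  rw [ENNReal.mul_rpow_of_nonneg _ _ hσ.le, ← ENNReal.rpow_mul, one_div_mul_eq_div]

/-- Restricting the Haar expansion of the counterexample function to the steps `j ∈ G` of the
chain gives a function that is at least `1` on the layers `X j \ X (j + 1)` with `j ∈ G`, and at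
most `0` on the other layers. -/
lemma exists_haar_projection {Ω : Type} [MeasurableSpace Ω] {μ : Measure Ω} [IsFiniteMeasure μ]
    {F : FiltrationAtoms Ω μ} (hbin : F.IsBinary) {Φ : ℕ → Ω → ℝ} (hΦ : IsGenHaar F Φ)
    {n : ℕ} {X : ℕ → Set Ω} (h0 : X 0 ∈ F.Atoms)
    (hX : ∀ j < n, F.IsChildOf (X (j + 1)) (X j)) (G : Finset ℕ) (hG : ∀ j ∈ G, j < n) :
    ∃ Γ : Finset ℕ, (∀ ℓ ∈ Γ, ExpansionCoef Φ μ (cexFun μ (X 0 \ X n) (X n)) ℓ ≠ 0) ∧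
      ∀ m < n, ∀ x ∈ X m \ X (m + 1),
        (m ∈ G → 1 ≤ ∑ ℓ ∈ Γ, ExpansionCoef Φ μ (cexFun μ (X 0 \ X n) (X n)) ℓ * Φ ℓ x) ∧
        (m ∉ G → ∑ ℓ ∈ Γ, ExpansionCoef Φ μ (cexFun μ (X 0 \ X n) (X n)) ℓ * Φ ℓ x ≤ 0) := by
  have hAt : ∀ {j}, j ≤ n → X j ∈ F.Atoms := fun hj => FiltrationAtoms.chain_mem_Atoms h0 hX hj
  have hpos : ∀ {j}, j ≤ n → 0 < μ.real (X j) := fun hj =>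
    ENNReal.toReal_pos (F.measure_pos_of_mem_Atoms (hAt hj)).ne' (measure_ne_top _ _)
  have hidx := fun j (hj : j < n) => hΦ.exists_index hbin (hX j hj)
  choose! τ hτ hτ' a b hz ha hb hab hb2 habm hb0 using hidx
  have hcoef : ∀ j < n, ExpansionCoef Φ μ (cexFun μ (X 0 \ X n) (X n)) (τ j + 1) =
      -(b j * μ.real (X 0)) := fun j hj =>
    expansionCoef_cexFun (F.measurableSet_of_mem_Atoms (hAt hj.le))
      (F.measurableSet_of_mem_Atoms (hAt hj)) (F.measurableSet_of_mem_Atoms (hAt le_rfl))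
      (F.measure_pos_of_mem_Atoms (hAt le_rfl)).ne' (FiltrationAtoms.chain_subset hX hj le_rfl)
      (hX j hj).ssubset.1 (FiltrationAtoms.chain_subset hX (Nat.zero_le _) hj.le)
      (hz j hj) (ha j hj) (hb j hj) (hab j hj)
  have hinj : Set.InjOn (fun j => τ j + 1) G := by
    intro i hi j hj hij
    have hi := hG i hi
    have hj := hG j hj
    have hij : τ i = τ j := by simpa using hij
    have hXX : X i = X j := hbin.eq_of_ssubset (hτ i hi) (hij ▸ hτ j hj) (hτ' i hi)
      (hij ▸ hτ' j hj) (hX i hi).ssubset (hX j hj).ssubset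
    rcases lt_trichotomy i j with h | h | h
    · exact absurd hXX.symm (FiltrationAtoms.chain_ssubset hX h hj.le).ne
    · exact h
    · exact absurd hXX (FiltrationAtoms.chain_ssubset hX h hi.le).ne
  refine ⟨G.image fun j => τ j + 1, ?_, ?_⟩
  · intro ℓ hℓ
    obtain ⟨j, hj, rfl⟩ := Finset.mem_image.1 hℓ
    rw [hcoef j (hG j hj)]
    exact neg_ne_zero.2 (mul_ne_zero (hb0 j (hG j hj)) (hpos (Nat.zero_le _)).ne')
  · intro m hm x hx
    rw [Finset.sum_image hinj]
    set u : ℕ → ℝ := fun j => μ.real (X 0) * (μ.real (X j))⁻¹ with hu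
    have hu0 : u 0 = 1 := mul_inv_cancel₀ (hpos (Nat.zero_le _)).ne'
    rw [← hu0]
    refine sum_telescope_bounds (m := m) (u := u) (t := fun j =>
      ExpansionCoef Φ μ (cexFun μ (X 0 \ X n) (X n)) (τ j + 1) * Φ (τ j + 1) x) ?_ ?_ ?_ ?_
    · intro i j hij
      have hmm : min i m ≤ min j m := min_le_min_right m hij
      have hjn : min j m ≤ n := (min_le_right _ _).trans hm.le
      exact mul_le_mul_of_nonneg_left (inv_anti₀ (hpos hjn)
        (measureReal_mono (FiltrationAtoms.chain_subset hX hmm hjn))) measureReal_nonneg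
    · intro j hj
      have hxj : x ∈ X (j + 1) := FiltrationAtoms.chain_subset hX hj hm.le hx.1
      have hjn := hj.trans hm
      simp only [hcoef j hjn, hb j hjn x hxj, hu]
      linear_combination -(μ.real (X 0)) * hb2 j hjn
    · simp only [hcoef m hm, ha m hm x hx, hu]
      linear_combination -(μ.real (X 0)) * habm m hm
    · intro j hj hmj
      have hjn := hG j hj
      have hxj : x ∉ X j := fun h => hx.2 (FiltrationAtoms.chain_subset hX hmj hjn.le h)
      simp only [hz j hjn x hxj, mul_zero]

/-- Work on `Ω = [0,1)` with Lebesgue measure, a binary filtration and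
`S = span{1_Ω}`, with generalized Haar system `Φ`. If condition `w3(𝒜,p,σ)` fails for some
`1 < p < ∞`, `0 < σ < p`, then (with constants `C, c > 0` independent of `N`) for every
`N ≥ 1` there is a chain of atoms `(X_i)_{i=0}^n` such that
`f = 1_{X_0∖X_n} − γ 1_{X_n}` (with mean zero) satisfies
(1) `‖f‖_{V_{σ,p}} ≤ C |X_0∖X_n|^{1/p}`, and
(2) there is a subset `Γ` of the Haar support of `f` with
`|∑_{ℓ∈Γ} ⟨f,φ_ℓ⟩ φ_ℓ|_{V_{σ,p}} ≥ c N |X_0∖X_n|^{1/p}`. -/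
theorem statement19
    (F : FiltrationAtoms UnitIco vol01) (hbin : F.IsBinary)
    (Φ : ℕ → UnitIco → ℝ) (hΦ : IsGenHaar F Φ)
    (p σ : ℝ) (hp : 1 < p) (hσ : 0 < σ) (hσp : σ < p)
    (hw3 : ¬ W3Cond F p σ) :
    ∃ C c : ℝ, 0 < C ∧ 0 < c ∧ ∀ N : ℕ, 0 < N →
      ∃ n : ℕ, 1 ≤ n ∧ ∃ X : ℕ → Set UnitIco, X 0 ∈ F.Atoms ∧
        (∀ j < n, F.IsChildOf (X (j + 1)) (X j)) ∧
        varNorm F constS σ p (cexFun vol01 (X 0 \ X n) (X n)) ≤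
          ENNReal.ofReal (C * (vol01 (X 0 \ X n)).toReal ^ (1 / p)) ∧
        ∃ Γ : Finset ℕ,
          (∀ ℓ ∈ Γ, ExpansionCoef Φ vol01 (cexFun vol01 (X 0 \ X n) (X n)) ℓ ≠ 0) ∧
          ENNReal.ofReal ((c * N) * (vol01 (X 0 \ X n)).toReal ^ (1 / p)) ≤
            varSeminorm F constS σ p (fun ω => ∑ ℓ ∈ Γ,
              ExpansionCoef Φ vol01 (cexFun vol01 (X 0 \ X n) (X n)) ℓ * Φ ℓ ω) := by
  refine ⟨(1 + 3 ^ (1 / σ)) * 2, 1 / 2, by positivity, by norm_num, fun N hN => ?_⟩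
  have hp0 : 0 < p := by linarith
  simp only [W3Cond, not_exists, not_and] at hw3
  have h := hw3 (1 / 2) ⟨by norm_num, by norm_num⟩ N (by exact_mod_cast hN)
  push Not at h
  obtain ⟨n, X, h0, hX, hhalf, k, lam, hlam0, hlamk, hlam, Γ, hΓ, hlt⟩ := h
  have hmono : ∀ {i j}, i ≤ j → j ≤ k → lam i ≤ lam j := by
    intro i j hij hj
    induction j, hij using Nat.le_induction with
    | base => exact le_rfl
    | succ j _ ih => exact (ih (by omega)).trans (hlam j (by omega)).le
  have hn : 1 ≤ n := by
    by_contra hn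
    have hk : k = 0 := by
      by_contra hk
      have h1 := hlam 0 (by omega)
      have h2 := hmono (i := 1) (j := k) (by omega) le_rfl
      simp only [zero_add] at h1
      omega
    subst hk
    simp [ENNReal.zero_rpow_of_pos (inv_pos.2 hσ)] at hlt
  refine ⟨n, hn, X, h0, hX, ?_, ?_⟩
  · have hAt : X n ∈ F.Atoms := FiltrationAtoms.chain_mem_Atoms h0 hX le_rfl
    have hsub : X n ⊆ X 0 := FiltrationAtoms.chain_subset hX (Nat.zero_le _) le_rfl
    have hle : vol01 (X 0 \ X n) ≤ vol01 (X n) := by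
      rw [measure_sdiff hsub (F.measurableSet_of_mem_Atoms hAt).nullMeasurableSet
        (measure_ne_top _ _), tsub_le_iff_right, ← two_mul]
      calc vol01 (X 0) = 2 * (ENNReal.ofReal (1 / 2) * vol01 (X 0)) := by
            rw [← mul_assoc, ← ENNReal.ofReal_ofNat, ← ENNReal.ofReal_mul (by norm_num)]
            norm_num
        _ ≤ 2 * vol01 (X n) := by gcongr
    obtain ⟨n, rfl⟩ := Nat.exists_eq_add_of_le' hn
    refine (varNorm_cexFun_le hp hσ h0 hX hle).trans (le_of_eq ?_)
    rw [ENNReal.ofReal_mul (by positivity), ENNReal.ofReal_mul (by positivity),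
      ENNReal.ofReal_add (by positivity) (by positivity),
      ← ENNReal.ofReal_rpow_of_nonneg ENNReal.toReal_nonneg (by positivity),
      ENNReal.ofReal_toReal (measure_ne_top _ _),
      ← ENNReal.ofReal_rpow_of_nonneg (by norm_num) (by positivity)]
    simp [mul_assoc]
  · have hlamn : ∀ {i}, i ≤ k → lam i ≤ n := fun hi => hlamk ▸ hmono hi le_rfl
    set G := (Finset.range n).filter fun j => ∃ i < k, j ∈ Γ i
    obtain ⟨Γ', hne, hval⟩ := exists_haar_projection hbin hΦ h0 hX G
      fun j hj => Finset.mem_range.1 (Finset.mem_filter.1 hj).1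
    refine ⟨Γ', hne, ?_⟩
    have hmeas : ∀ {j}, j ≤ n → MeasurableSet (X j) := fun hj =>
      F.measurableSet_of_mem_Atoms (FiltrationAtoms.chain_mem_Atoms h0 hX hj)
    have hvar := half_sum_le_varSeminorm (F := F) (p := p) (σ := σ) hp0 hσ (k := k)
      (R := fun i => X (lam i) \ X (lam (i + 1))) (Q := fun i => ⋃ j ∈ Γ i, X j \ X (j + 1))
      (g := fun x => ∑ ℓ ∈ Γ',
        ExpansionCoef Φ vol01 (cexFun vol01 (X 0 \ X n) (X n)) ℓ * Φ ℓ x)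
      (fun i hi => Or.inr ⟨_, FiltrationAtoms.chain_mem_Atoms h0 hX (hlamn hi.le), _,
        FiltrationAtoms.chain_mem_Atoms h0 hX (hlamn hi),
        FiltrationAtoms.chain_subset hX (hlam i hi).le (hlamn hi), rfl,
        nonempty_of_ssubset (FiltrationAtoms.chain_ssubset hX (hlam i hi) (hlamn hi))⟩)
      (fun i hi => (hmeas (hlamn hi.le)).diff (hmeas (hlamn hi)))
      (fun i hi => nonempty_of_ssubset (FiltrationAtoms.chain_ssubset hX (hlam i hi) (hlamn hi)))
      ?_ ?_ ?_ ?_ ?_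
    · refine le_trans ?_ ((mul_le_mul_right hlt.le _).trans hvar)
      rw [ENNReal.ofReal_mul (by positivity), ENNReal.ofReal_mul (by positivity),
        ← ENNReal.ofReal_rpow_of_nonneg ENNReal.toReal_nonneg (by positivity),
        ENNReal.ofReal_toReal (measure_ne_top _ _), mul_assoc]
    · have hd : ∀ i < k, ∀ i' < k, i < i' →
          Disjoint (X (lam i) \ X (lam (i + 1))) (X (lam i') \ X (lam (i' + 1))) :=
        fun i _ i' hi' hii' => disjoint_left.2 fun x hx hx' => hx.2
          (FiltrationAtoms.chain_subset hX (hmono hii' hi'.le) (hlamn hi'.le) hx'.1)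
      intro i hi i' hi' hii'
      rcases lt_or_gt_of_ne hii' with h | h
      · exact hd i hi i' hi' h
      · exact (hd i' hi' i hi h).symm
    · intro i hi
      refine MeasurableSet.biUnion (to_countable _) fun j hj => ?_
      have hj' := (hΓ i hj).2
      have := hlamn (i := i + 1) hi
      exact (hmeas (by omega)).diff (hmeas (by omega))
    · intro i hi
      refine iUnion₂_subset fun j hj => ?_
      have hj' := hΓ i hj
      have := hlamn (i := i + 1) hi
      exact sdiff_subset_sdiff (FiltrationAtoms.chain_subset hX hj'.1 (hj'.2.le.trans this))
        (FiltrationAtoms.chain_subset hX hj'.2 this)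
    · intro i hi x hx
      obtain ⟨j, hj, hxj⟩ := mem_iUnion₂.1 hx
      have hjn : j < n := (hΓ i hj).2.trans_le (hlamn hi)
      exact (hval j hjn x hxj).1 (Finset.mem_filter.2 ⟨Finset.mem_range.2 hjn, i, hi, hj⟩)
    · intro i hi x hx
      obtain ⟨m, h1, h2, hxm⟩ := exists_mem_chain_diff (hlam i hi).le hx.1
      refine (hval m (h2.trans_le (hlamn hi)) x hxm).2 fun hmG => ?_
      obtain ⟨-, i', hi', hmi'⟩ := Finset.mem_filter.1 hmG
      have h3 := hΓ i' hmi'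
      have hii' : i' = i := by
        rcases lt_trichotomy i' i with h | h | h
        · exact absurd (h3.2.trans_le (hmono h hi.le)) (by omega)
        · exact h
        · exact absurd (h2.trans_le (hmono h hi'.le)) (by have := h3.1; omega)
      subst hii'
      exact hx.2 (mem_iUnion₂.2 ⟨m, hmi', hxm⟩)
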